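/- arXiv:2112.01666 — 2 statements merged into one kernel-verified Lean document; each statement's English description precedes it below -/
import Mathlib

section
/- Let 𝒱 ⊂ ℝ³ be the set of the N = 24 vertices of the truncated octahedron: all vectors obtained as coordinate permutations of (0,±1,±2). Then max_{v ∈ 𝒱^N̲} |⟨v⟩|₂² = 183440. Consequently, for the unit-normalized ensemble 𝒱/√5 one has g = 183440/5, and its minimum guesswork is (1/2)·(25 − √(183440/5)/24) ≈ 8.5096. -/
open Pointwise

noncomputable section

abbrev E3 := EuclideanSpace ℝ (Fin 3)

/-- The vector `(a, b, c)` in ℝ³ with the Euclidean norm. -/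
def vec3 (a b c : ℝ) : E3 := (WithLp.equiv 2 (Fin 3 → ℝ)).symm ![a, b, c]

/-- `⟨v⟩ := Σ_{i=1}^N (2i − N + 1)·vᵢ` (here `i : Fin N` is 0-based, so the
coefficient reads `2(i+1) − N + 1 = 2i + 3 − N`). -/
def tupleAvg (N : ℕ) (v : Fin N → E3) : E3 :=
  ∑ i : Fin N, (2 * (i : ℝ) + 3 - N) • v i

/-- The set of values `|⟨v⟩|₂²` as `v` ranges over the `N`-tuples on `𝒱` without
repetition (i.e. bijective enumerations of `𝒱`). -/
def normSqSet (𝒱 : Set E3) (N : ℕ) : Set ℝ :=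
  {x | ∃ v : Fin N → E3, Function.Injective v ∧ Set.range v = 𝒱 ∧ x = ‖tupleAvg N v‖ ^ 2}

/-- All coordinate permutations of `(0, ±1, ±2)`. -/
def truncatedOctahedron : Set E3 :=
  {v | ∃ σ : Equiv.Perm (Fin 3), ∃ s : Fin 3 → ℝ, (∀ i, s i = 1 ∨ s i = -1) ∧
       v = (WithLp.equiv 2 (Fin 3 → ℝ)).symm (fun i => s i * ![0, 1, 2] (σ i))}

/-- Integer vectors in three dimensions, as triples so that the kernel computes with them quickly. -/
abbrev Z3 := ℤ × ℤ × ℤ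

def Z3.dot (a b : Z3) : ℤ := a.1 * b.1 + a.2.1 * b.2.1 + a.2.2 * b.2.2

def Z3.comb (p : ℤ) (a : Z3) (q : ℤ) (b : Z3) : Z3 :=
  (p * a.1 + q * b.1, p * a.2.1 + q * b.2.1, p * a.2.2 + q * b.2.2)

/-- Add the term `|⟨d, ·⟩|` to a weighted list of such terms, merging it with a parallel one. -/
def insertForm (d : Z3) : List (ℤ × Z3) → List (ℤ × Z3)
  | [] => [(1, d)]
  | (m, e) :: l =>
    if e = d ∨ e = Z3.comb (-1) d 0 d then (m + 1, e) :: l else (m, e) :: insertForm d l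

/-- Move the terms whose sign is constant on the cone spanned by `r₁, r₂, r₃` into the
linear part `w`. -/
def absorb (r₁ r₂ r₃ : Z3) : List (ℤ × Z3) → Z3 → List (ℤ × Z3) × Z3
  | [], w => ([], w)
  | (m, d) :: l, w =>
    if 0 ≤ d.dot r₁ ∧ 0 ≤ d.dot r₂ ∧ 0 ≤ d.dot r₃ then absorb r₁ r₂ r₃ l (Z3.comb 1 w m d)
    else if d.dot r₁ ≤ 0 ∧ d.dot r₂ ≤ 0 ∧ d.dot r₃ ≤ 0 then
      absorb r₁ r₂ r₃ l (Z3.comb 1 w (-m) d)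
    else
      let res := absorb r₁ r₂ r₃ l w
      ((m, d) :: res.1, res.2)

/-- A positive combination of `r₁` and `r₂` on which a form with values `a` and `b` of opposite
signs vanishes. -/
def splitRay (a b : ℤ) (r₁ r₂ : Z3) : Z3 :=
  Z3.comb (b.natAbs / Nat.gcd a.natAbs b.natAbs : ℕ) r₁
    (a.natAbs / Nat.gcd a.natAbs b.natAbs : ℕ) r₂

/-- Check that on the cone spanned by `r₁, r₂, r₃` the function `⟨w, ·⟩ + ∑ m |⟨d, ·⟩|` is
piecewise linear with all gradients of squared norm at most `B`, by subdividing the cone until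
each form has constant sign. -/
def gradientCheck (B : ℤ) : ℕ → Z3 → Z3 → Z3 → List (ℤ × Z3) → Z3 → Bool
  | 0, _, _, _, _, _ => false
  | n + 1, r₁, r₂, r₃, l, w =>
    match absorb r₁ r₂ r₃ l w with
    | ([], w') => decide (w'.dot w' ≤ B)
    | ((m, d) :: l', w') =>
      if d.dot r₁ * d.dot r₂ < 0 then
        let r := splitRay (d.dot r₁) (d.dot r₂) r₁ r₂
        gradientCheck B n r r₂ r₃ ((m, d) :: l') w' && gradientCheck B n r₁ r r₃ ((m, d) :: l') w'
      else if d.dot r₂ * d.dot r₃ < 0 then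
        let r := splitRay (d.dot r₂) (d.dot r₃) r₂ r₃
        gradientCheck B n r₁ r r₃ ((m, d) :: l') w' && gradientCheck B n r₁ r₂ r ((m, d) :: l') w'
      else if d.dot r₁ * d.dot r₃ < 0 then
        let r := splitRay (d.dot r₁) (d.dot r₃) r₁ r₃
        gradientCheck B n r r₂ r₃ ((m, d) :: l') w' && gradientCheck B n r₁ r₂ r ((m, d) :: l') w'
      else false

/-- The vertices of the truncated octahedron, in an order maximizing the norm of `tupleAvg`. -/
def vertex : Fin 24 → Z3 :=
  ![(-2, -1, 0), (-2, 0, -1), (-1, -2, 0), (-2, 0, 1), (-2, 1, 0), (-1, 0, -2), (0, -2, -1),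
    (0, -1, -2), (0, -2, 1), (-1, 0, 2), (-1, 2, 0), (0, -1, 2), (0, 1, -2), (1, -2, 0),
    (1, 0, -2), (0, 2, -1), (0, 1, 2), (0, 2, 1), (1, 0, 2), (2, -1, 0), (2, 0, -1),
    (1, 2, 0), (2, 0, 1), (2, 1, 0)]

/-- The differences of all pairs of vertices. -/
def vertexDiffs : List Z3 :=
  (List.finRange 24).flatMap fun i => (List.finRange 24).map fun j =>
    Z3.comb 1 (vertex i) (-1) (vertex j)

def mergedDiffs : List (ℤ × Z3) := vertexDiffs.foldr insertForm []

theorem gradientCheck_octant :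
    gradientCheck (4 * 183440) 25 (1, 0, 0) (0, 1, 0) (0, 0, 1) mergedDiffs (0, 0, 0) = true := by
  decide +kernel

def Z3.eval (d : Z3) (u : E3) : ℝ := d.1 * u 0 + d.2.1 * u 1 + d.2.2 * u 2

def Z3.toE3 (d : Z3) : E3 := vec3 d.1 d.2.1 d.2.2

theorem Z3.inner_toE3 (d : Z3) (u : E3) : inner ℝ d.toE3 u = d.eval u := by
  simp [Z3.toE3, vec3, Z3.eval, PiLp.inner_apply, Fin.sum_univ_three, mul_comm]

theorem Z3.eval_comb (p q : ℤ) (a b : Z3) (u : E3) :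
    (Z3.comb p a q b).eval u = p * a.eval u + q * b.eval u := by
  simp only [Z3.eval, Z3.comb]
  push_cast
  ring

theorem Z3.toE3_comb (p q : ℤ) (a b : Z3) :
    (Z3.comb p a q b).toE3 = (p : ℝ) • a.toE3 + (q : ℝ) • b.toE3 := by
  ext k
  fin_cases k <;> simp [Z3.toE3, Z3.comb, vec3]

theorem Z3.eval_toE3 (d r : Z3) : d.eval r.toE3 = d.dot r := by
  simp [Z3.eval, Z3.toE3, vec3, Z3.dot]

/-- The convex cone spanned by three integer vectors. -/
def InCone (r₁ r₂ r₃ : Z3) (u : E3) : Prop :=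
  ∃ x y z : ℝ, 0 ≤ x ∧ 0 ≤ y ∧ 0 ≤ z ∧ u = x • r₁.toE3 + y • r₂.toE3 + z • r₃.toE3

theorem InCone.rotate {r₁ r₂ r₃ : Z3} {u : E3} (h : InCone r₁ r₂ r₃ u) : InCone r₂ r₃ r₁ u := by
  obtain ⟨x, y, z, hx, hy, hz, rfl⟩ := h
  exact ⟨y, z, x, hy, hz, hx, by abel⟩

theorem InCone.swap {r₁ r₂ r₃ : Z3} {u : E3} (h : InCone r₁ r₂ r₃ u) : InCone r₁ r₃ r₂ u := by
  obtain ⟨x, y, z, hx, hy, hz, rfl⟩ := h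
  exact ⟨x, z, y, hx, hz, hy, by abel⟩

theorem InCone.eval_eq {r₁ r₂ r₃ : Z3} {u : E3} (h : InCone r₁ r₂ r₃ u) :
    ∃ x y z : ℝ, 0 ≤ x ∧ 0 ≤ y ∧ 0 ≤ z ∧
      ∀ d : Z3, d.eval u = x * d.dot r₁ + y * d.dot r₂ + z * d.dot r₃ := by
  obtain ⟨x, y, z, hx, hy, hz, rfl⟩ := h
  refine ⟨x, y, z, hx, hy, hz, fun d => ?_⟩
  simp only [← Z3.eval_toE3, Z3.eval, PiLp.add_apply, PiLp.smul_apply, smul_eq_mul]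
  ring

theorem InCone.eval_nonneg {r₁ r₂ r₃ d : Z3} {u : E3} (h : InCone r₁ r₂ r₃ u)
    (h₁ : 0 ≤ d.dot r₁) (h₂ : 0 ≤ d.dot r₂) (h₃ : 0 ≤ d.dot r₃) : 0 ≤ d.eval u := by
  obtain ⟨x, y, z, hx, hy, hz, hd⟩ := h.eval_eq
  rw [hd]
  have h₁' : (0 : ℝ) ≤ d.dot r₁ := by exact_mod_cast h₁
  have h₂' : (0 : ℝ) ≤ d.dot r₂ := by exact_mod_cast h₂
  have h₃' : (0 : ℝ) ≤ d.dot r₃ := by exact_mod_cast h₃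
  positivity

theorem InCone.eval_nonpos {r₁ r₂ r₃ d : Z3} {u : E3} (h : InCone r₁ r₂ r₃ u)
    (h₁ : d.dot r₁ ≤ 0) (h₂ : d.dot r₂ ≤ 0) (h₃ : d.dot r₃ ≤ 0) : d.eval u ≤ 0 := by
  obtain ⟨x, y, z, hx, hy, hz, hd⟩ := h.eval_eq
  rw [hd]
  have h₁' : (d.dot r₁ : ℝ) ≤ 0 := by exact_mod_cast h₁
  have h₂' : (d.dot r₂ : ℝ) ≤ 0 := by exact_mod_cast h₂
  have h₃' : (d.dot r₃ : ℝ) ≤ 0 := by exact_mod_cast h₃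
  linarith [mul_nonpos_of_nonneg_of_nonpos hx h₁', mul_nonpos_of_nonneg_of_nonpos hy h₂',
    mul_nonpos_of_nonneg_of_nonpos hz h₃']

theorem InCone.split {r₁ r₂ r₃ : Z3} {u : E3} (h : InCone r₁ r₂ r₃ u) {a b : ℤ} (hab : a * b < 0) :
    InCone (splitRay a b r₁ r₂) r₂ r₃ u ∨ InCone r₁ (splitRay a b r₁ r₂) r₃ u := by
  have ha : a ≠ 0 := by rintro rfl; simp at hab
  have hb : b ≠ 0 := by rintro rfl; simp at hab
  obtain ⟨x, y, z, hx, hy, hz, rfl⟩ := h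
  obtain ⟨p, hp⟩ : ∃ p : ℕ, p = b.natAbs / Nat.gcd a.natAbs b.natAbs := ⟨_, rfl⟩
  obtain ⟨q, hq⟩ : ∃ q : ℕ, q = a.natAbs / Nat.gcd a.natAbs b.natAbs := ⟨_, rfl⟩
  have hp0 : (0 : ℝ) < p := by
    rw [hp]
    exact_mod_cast Nat.div_gcd_pos_of_pos_right _ (Int.natAbs_pos.2 hb)
  have hq0 : (0 : ℝ) < q := by
    rw [hq]
    exact_mod_cast Nat.div_gcd_pos_of_pos_left _ (Int.natAbs_pos.2 ha)
  have hr : splitRay a b r₁ r₂ = Z3.comb p r₁ q r₂ := by rw [hp, hq, splitRay]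
  rw [hr]
  rcases le_total (x * q) (y * p) with hxy | hxy
  · left
    refine ⟨x / p, y - x / p * q, z, by positivity, ?_, hz, ?_⟩
    · rw [sub_nonneg, div_mul_eq_mul_div, div_le_iff₀ hp0]
      exact hxy
    · have hxp : x = x / p * p := by field_simp
      rw [Z3.toE3_comb]
      push_cast
      conv_lhs => rw [hxp]
      module
  · right
    refine ⟨x - y / q * p, y / q, z, ?_, by positivity, hz, ?_⟩
    · rw [sub_nonneg, div_mul_eq_mul_div, div_le_iff₀ hq0]
      exact hxy
    · have hyq : y = y / q * q := by field_simp
      rw [Z3.toE3_comb]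
      push_cast
      conv_lhs => rw [hyq]
      module

def absSum (l : List (ℤ × Z3)) (u : E3) : ℝ := (l.map fun md => (md.1 : ℝ) * |md.2.eval u|).sum

theorem absSum_cons (m : ℤ) (d : Z3) (l : List (ℤ × Z3)) (u : E3) :
    absSum ((m, d) :: l) u = m * |d.eval u| + absSum l u := by
  simp [absSum]

theorem absSum_insertForm (d : Z3) (l : List (ℤ × Z3)) (u : E3) :
    absSum (insertForm d l) u = |d.eval u| + absSum l u := by
  induction l with
  | nil => simp [insertForm, absSum]
  | cons md l ih =>
    obtain ⟨m, e⟩ := md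
    rw [insertForm]
    split_ifs with h
    · have he : |e.eval u| = |d.eval u| := by
        rcases h with rfl | rfl
        · rfl
        · simp [Z3.eval_comb]
      rw [absSum_cons, absSum_cons, he]
      push_cast
      ring
    · rw [absSum_cons, absSum_cons, ih]
      ring

theorem absSum_foldr_insertForm (l : List Z3) (u : E3) :
    absSum (l.foldr insertForm []) u = (l.map fun d => |d.eval u|).sum := by
  induction l with
  | nil => simp [absSum]
  | cons d l ih => rw [List.foldr_cons, absSum_insertForm, ih, List.map_cons, List.sum_cons]

theorem absorb_eval {r₁ r₂ r₃ : Z3} {u : E3} (hu : InCone r₁ r₂ r₃ u) (l : List (ℤ × Z3)) (w : Z3) :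
    (absorb r₁ r₂ r₃ l w).2.eval u + absSum (absorb r₁ r₂ r₃ l w).1 u =
      w.eval u + absSum l u := by
  induction l generalizing w with
  | nil => rfl
  | cons md l ih =>
    obtain ⟨m, d⟩ := md
    rw [absorb]
    split_ifs with h₁ h₂
    · rw [ih, absSum_cons, abs_of_nonneg (hu.eval_nonneg h₁.1 h₁.2.1 h₁.2.2), Z3.eval_comb]
      push_cast
      ring
    · rw [ih, absSum_cons, abs_of_nonpos (hu.eval_nonpos h₂.1 h₂.2.1 h₂.2.2), Z3.eval_comb]
      push_cast
      ring
    · simp only [absSum_cons]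
      linarith [ih w]

theorem gradientCheck_sound (B : ℤ) (n : ℕ) {r₁ r₂ r₃ : Z3} {l : List (ℤ × Z3)} {w : Z3} {u : E3}
    (h : gradientCheck B n r₁ r₂ r₃ l w = true) (hu : InCone r₁ r₂ r₃ u) :
    ∃ w' : Z3, w'.dot w' ≤ B ∧ w.eval u + absSum l u = w'.eval u := by
  induction n generalizing r₁ r₂ r₃ l w with
  | zero => simp [gradientCheck] at h
  | succ n ih =>
    rw [← absorb_eval hu, gradientCheck] at *
    generalize absorb r₁ r₂ r₃ l w = res at *
    obtain ⟨l', w'⟩ := res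
    cases l' with
    | nil => exact ⟨w', by simpa using h, by simp [absSum]⟩
    | cons md l' =>
      simp only at h
      split_ifs at h with h₁ h₂ h₃
      · rw [Bool.and_eq_true] at h
        rcases hu.split h₁ with hu | hu
        · exact ih h.1 hu
        · exact ih h.2 hu
      · rw [Bool.and_eq_true] at h
        rcases hu.rotate.split h₂ with hu | hu
        · exact ih h.1 hu.rotate.rotate
        · exact ih h.2 hu.rotate.rotate
      · rw [Bool.and_eq_true] at h
        rcases hu.swap.split h₃ with hu | hu
        · exact ih h.1 hu.swap
        · exact ih h.2 hu.swap

def pairSum (u : E3) : ℝ := ∑ i, ∑ j, |(vertex i).eval u - (vertex j).eval u|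

theorem absSum_mergedDiffs (u : E3) : absSum mergedDiffs u = pairSum u := by
  rw [mergedDiffs, absSum_foldr_insertForm, vertexDiffs, List.map_flatMap, pairSum]
  simp [Fin.sum_univ_def, List.flatMap, List.sum_flatten, Function.comp_def, Z3.eval_comb,
    sub_eq_add_neg]

def reflect (a b c : ℤ) (d : Z3) : Z3 := (a * d.1, b * d.2.1, c * d.2.2)

theorem exists_vertex_reflect : ∀ a ∈ [1, -1], ∀ b ∈ [1, -1], ∀ c ∈ [1, -1],
    ∀ i, ∃ j, vertex j = reflect a b c (vertex i) := by
  decide +kernel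

theorem vertex_injective : Function.Injective vertex := by
  decide +kernel

theorem exists_sign_abs (x : ℝ) : ∃ a ∈ [(1 : ℤ), -1], |x| = a * x := by
  rcases abs_choice x with h | h
  · exact ⟨1, by simp, by simp [h]⟩
  · exact ⟨-1, by simp, by simp [h]⟩

theorem pairSum_abs (u : E3) : pairSum (vec3 |u 0| |u 1| |u 2|) = pairSum u := by
  obtain ⟨a, ha, ha'⟩ := exists_sign_abs (u 0)
  obtain ⟨b, hb, hb'⟩ := exists_sign_abs (u 1)
  obtain ⟨c, hc, hc'⟩ := exists_sign_abs (u 2)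
  choose π hπ using exists_vertex_reflect a ha b hb c hc
  have hne : ∀ {x : ℤ}, x ∈ [(1 : ℤ), -1] → x ≠ 0 := by
    intro x hx
    rintro rfl
    simp at hx
  have hinj : Function.Injective π := by
    intro i j hij
    apply vertex_injective
    have h := (hπ i).symm.trans ((congrArg vertex hij).trans (hπ j))
    simp only [reflect, Prod.mk.injEq, mul_right_inj' (hne ha), mul_right_inj' (hne hb),
      mul_right_inj' (hne hc)] at h
    exact Prod.ext h.1 (Prod.ext h.2.1 h.2.2)
  have hbij : Function.Bijective π := Finite.injective_iff_bijective.1 hinj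
  have heval : ∀ i, (vertex i).eval (vec3 |u 0| |u 1| |u 2|) = (vertex (π i)).eval u := by
    intro i
    rw [hπ]
    simp [Z3.eval, vec3, reflect, ha', hb', hc']
    ring
  simp only [pairSum, heval]
  rw [hbij.sum_comp fun i => ∑ j, |(vertex i).eval u - (vertex (π j)).eval u|]
  exact Finset.sum_congr rfl fun i _ =>
    hbij.sum_comp fun j => |(vertex i).eval u - (vertex j).eval u|

theorem norm_sq_eq (u : E3) : ‖u‖ ^ 2 = u 0 ^ 2 + u 1 ^ 2 + u 2 ^ 2 := by
  rw [EuclideanSpace.norm_sq_eq, Fin.sum_univ_three]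
  simp

theorem pairSum_sq_le (u : E3) : pairSum u ^ 2 ≤ 4 * 183440 * ‖u‖ ^ 2 := by
  have hcone : InCone (1, 0, 0) (0, 1, 0) (0, 0, 1) (vec3 |u 0| |u 1| |u 2|) := by
    refine ⟨|u 0|, |u 1|, |u 2|, abs_nonneg _, abs_nonneg _, abs_nonneg _, ?_⟩
    ext k
    fin_cases k <;> simp [Z3.toE3, vec3]
  obtain ⟨w, hw, h⟩ := gradientCheck_sound _ _ gradientCheck_octant hcone
  rw [absSum_mergedDiffs, pairSum_abs] at h
  have h₀ : pairSum u = inner ℝ w.toE3 (vec3 |u 0| |u 1| |u 2|) := by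
    rw [Z3.inner_toE3, ← h]
    simp [Z3.eval]
  have hn : ‖vec3 |u 0| |u 1| |u 2|‖ ^ 2 = ‖u‖ ^ 2 := by
    simp [norm_sq_eq, vec3]
  have hw' : ‖w.toE3‖ ^ 2 ≤ 4 * 183440 := by
    rw [← real_inner_self_eq_norm_sq, Z3.inner_toE3, Z3.eval_toE3]
    exact_mod_cast hw
  calc pairSum u ^ 2 ≤ (‖w.toE3‖ * ‖vec3 |u 0| |u 1| |u 2|‖) ^ 2 := by
        rw [h₀]
        exact sq_le_sq' (neg_le_of_abs_le (abs_real_inner_le_norm _ _)) (real_inner_le_norm _ _)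
    _ ≤ _ := by
        rw [mul_pow, hn]
        gcongr

theorem two_mul_sum_le_sum_abs_sub {N : ℕ} (x : Fin N → ℝ) (hx : ∑ i, x i = 0) :
    2 * ∑ i : Fin N, (2 * (i : ℝ) + 3 - N) * x i ≤ ∑ i, ∑ j, |x i - x j| := by
  let s : Fin N → Fin N → ℝ := fun i j => if j < i then 1 else if i < j then -1 else 0
  have hs : ∀ i, ∑ j, s i j = 2 * (i : ℝ) + 1 - N := by
    intro i
    have h : ∀ j, s i j = (if j < i then 1 else 0) - (if i < j then 1 else 0) := by
      intro j
      rcases lt_trichotomy i j with h | h | h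
      · simp [s, h, h.not_gt]
      · simp [s, h]
      · simp [s, h, h.not_gt]
    simp only [h, Finset.sum_sub_distrib, Finset.sum_boole, Finset.filter_gt_eq_Iio,
      Finset.filter_lt_eq_Ioi, Fin.card_Iio, Fin.card_Ioi]
    have := i.isLt
    rw [Nat.cast_sub (by omega), Nat.cast_sub (by omega)]
    push_cast
    ring
  have hanti : ∀ i j, s i j = -s j i := by
    intro i j
    rcases lt_trichotomy i j with h | h | h
    · simp [s, h, h.not_gt]
    · simp [s, h]
    · simp [s, h, h.not_gt]
  have hle : ∀ i j, s i j * (x i - x j) ≤ |x i - x j| := by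
    intro i j
    simp only [s]
    split_ifs
    · rw [one_mul]; exact le_abs_self _
    · rw [neg_one_mul]; exact neg_le_abs _
    · rw [zero_mul]; exact abs_nonneg _
  have hswap : ∑ i, ∑ j, s i j * x j = -∑ i, ∑ j, s i j * x i := by
    rw [Finset.sum_comm, ← Finset.sum_neg_distrib]
    refine Finset.sum_congr rfl fun i _ => ?_
    rw [← Finset.sum_neg_distrib]
    exact Finset.sum_congr rfl fun j _ => by rw [hanti j i]; ring
  calc 2 * ∑ i : Fin N, (2 * (i : ℝ) + 3 - N) * x i
      = 2 * ∑ i : Fin N, (2 * (i : ℝ) + 1 - N) * x i := by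
        have : ∑ i : Fin N, (2 * (i : ℝ) + 3 - N) * x i =
            ∑ i : Fin N, (2 * (i : ℝ) + 1 - N) * x i + 2 * ∑ i, x i := by
          rw [Finset.mul_sum, ← Finset.sum_add_distrib]
          exact Finset.sum_congr rfl fun i _ => by ring
        rw [this, hx, mul_zero, add_zero]
    _ = ∑ i, ∑ j, s i j * (x i - x j) := by
        simp only [mul_sub, Finset.sum_sub_distrib, hswap]
        simp only [← Finset.sum_mul, hs]
        ring
    _ ≤ _ := Finset.sum_le_sum fun i _ => Finset.sum_le_sum fun j _ => hle i j

theorem exists_vertex_eq : ∀ (σ : Equiv.Perm (Fin 3)) (s : Fin 3 → ℤˣ), ∃ i,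
    vertex i = ((s 0 : ℤ) * ![0, 1, 2] (σ 0), (s 1 : ℤ) * ![0, 1, 2] (σ 1),
      (s 2 : ℤ) * ![0, 1, 2] (σ 2)) := by
  decide +kernel

theorem exists_perm_sign_eq_vertex : ∀ i, ∃ (σ : Equiv.Perm (Fin 3)) (s : Fin 3 → ℤˣ),
    vertex i = ((s 0 : ℤ) * ![0, 1, 2] (σ 0), (s 1 : ℤ) * ![0, 1, 2] (σ 1),
      (s 2 : ℤ) * ![0, 1, 2] (σ 2)) := by
  decide +kernel

theorem toE3_perm_sign (σ : Equiv.Perm (Fin 3)) (s : Fin 3 → ℤˣ) :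
    Z3.toE3 ((s 0 : ℤ) * ![0, 1, 2] (σ 0), (s 1 : ℤ) * ![0, 1, 2] (σ 1),
      (s 2 : ℤ) * ![0, 1, 2] (σ 2)) =
    (WithLp.equiv 2 (Fin 3 → ℝ)).symm (fun i => ((s i : ℤ) : ℝ) * ![0, 1, 2] (σ i)) := by
  have h : ∀ k : Fin 3, ((![0, 1, 2] k : ℤ) : ℝ) = ![0, 1, 2] k := by
    intro k
    fin_cases k <;> simp
  ext k
  fin_cases k <;> simp [Z3.toE3, vec3, h]

theorem truncatedOctahedron_eq_range : truncatedOctahedron = Set.range fun i => (vertex i).toE3 := by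
  ext v
  constructor
  · rintro ⟨σ, s, hs, rfl⟩
    have : ∀ i, ∃ t : ℤˣ, s i = ((t : ℤ) : ℝ) := by
      intro i
      rcases hs i with h | h
      · exact ⟨1, by simp [h]⟩
      · exact ⟨-1, by simp [h]⟩
    choose t ht using this
    obtain ⟨i, hi⟩ := exists_vertex_eq σ t
    refine ⟨i, ?_⟩
    simp only [hi, toE3_perm_sign, ht]
  · rintro ⟨i, rfl⟩
    obtain ⟨σ, s, hi⟩ := exists_perm_sign_eq_vertex i
    refine ⟨σ, fun k => ((s k : ℤ) : ℝ), fun k => ?_, ?_⟩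
    · rcases Int.units_eq_one_or (s k) with h | h <;> simp [h]
    · simp only [hi, toE3_perm_sign]

theorem toE3_injective : Function.Injective Z3.toE3 := by
  rintro ⟨a, b, c⟩ ⟨a', b', c'⟩ h
  have h₀ := congrArg (fun v : E3 => v 0) h
  have h₁ := congrArg (fun v : E3 => v 1) h
  have h₂ := congrArg (fun v : E3 => v 2) h
  simp [Z3.toE3, vec3] at h₀ h₁ h₂
  simp [h₀, h₁, h₂]

theorem sum_vertex_eval (u : E3) : ∑ i, (vertex i).eval u = 0 := by
  have h₀ : ∑ i, (vertex i).1 = 0 := by decide +kernel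
  have h₁ : ∑ i, (vertex i).2.1 = 0 := by decide +kernel
  have h₂ : ∑ i, (vertex i).2.2 = 0 := by decide +kernel
  simp only [Z3.eval, Finset.sum_add_distrib, ← Finset.sum_mul, ← Int.cast_sum, h₀, h₁, h₂]
  simp

theorem tupleAvg_vertex : tupleAvg 24 (fun i => (vertex i).toE3) = vec3 384 172 80 := by
  have h₀ : ∑ i : Fin 24, (2 * (i : ℤ) + 3 - 24) * (vertex i).1 = 384 := by decide +kernel
  have h₁ : ∑ i : Fin 24, (2 * (i : ℤ) + 3 - 24) * (vertex i).2.1 = 172 := by decide +kernel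
  have h₂ : ∑ i : Fin 24, (2 * (i : ℤ) + 3 - 24) * (vertex i).2.2 = 80 := by decide +kernel
  ext k
  fin_cases k
  · simpa [tupleAvg, Z3.toE3, vec3] using congrArg (Int.cast : ℤ → ℝ) h₀
  · simpa [tupleAvg, Z3.toE3, vec3] using congrArg (Int.cast : ℤ → ℝ) h₁
  · simpa [tupleAvg, Z3.toE3, vec3] using congrArg (Int.cast : ℤ → ℝ) h₂

theorem norm_tupleAvg_sq_le {v : Fin 24 → E3} (hinj : Function.Injective v)
    (hv : Set.range v = truncatedOctahedron) : ‖tupleAvg 24 v‖ ^ 2 ≤ 183440 := by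
  have hmem : ∀ i, ∃ j, (vertex j).toE3 = v i := by
    intro i
    have : v i ∈ truncatedOctahedron := hv ▸ Set.mem_range_self i
    rwa [truncatedOctahedron_eq_range] at this
  choose e he using hmem
  have hbij : Function.Bijective e := Finite.injective_iff_bijective.1 fun i j hij =>
    hinj (by rw [← he, ← he, hij])
  set t := tupleAvg 24 v with ht
  have hnorm : ‖t‖ ^ 2 = ∑ i : Fin 24, (2 * (i : ℝ) + 3 - (24 : ℕ)) * (vertex (e i)).eval t := by
    rw [← real_inner_self_eq_norm_sq]
    nth_rewrite 1 [ht]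
    rw [tupleAvg, sum_inner]
    refine Finset.sum_congr rfl fun i _ => ?_
    rw [real_inner_smul_left, ← he, Z3.inner_toE3]
  have hle := two_mul_sum_le_sum_abs_sub (fun i => (vertex (e i)).eval t)
    ((hbij.sum_comp fun i => (vertex i).eval t).trans (sum_vertex_eval t))
  have hpair : ∑ i, ∑ j, |(vertex (e i)).eval t - (vertex (e j)).eval t| = pairSum t := by
    rw [hbij.sum_comp fun i => ∑ j, |(vertex i).eval t - (vertex (e j)).eval t|]
    exact Finset.sum_congr rfl fun i _ =>
      hbij.sum_comp fun j => |(vertex i).eval t - (vertex j).eval t|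
  rw [← hnorm, hpair] at hle
  have hsq := pairSum_sq_le t
  by_contra! hlt
  nlinarith [sq_nonneg ‖t‖]

theorem isGreatest_normSqSet_truncatedOctahedron :
    IsGreatest (normSqSet truncatedOctahedron 24) 183440 := by
  constructor
  · refine ⟨fun i => (vertex i).toE3, toE3_injective.comp vertex_injective,
      truncatedOctahedron_eq_range.symm, ?_⟩
    rw [tupleAvg_vertex, norm_sq_eq]
    simp [vec3]
    norm_num
  · rintro x ⟨v, hinj, hv, rfl⟩
    exact norm_tupleAvg_sq_le hinj hv

theorem tupleAvg_smul (N : ℕ) (c : ℝ) (v : Fin N → E3) : tupleAvg N (c • v) = c • tupleAvg N v := by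
  simp only [tupleAvg, Finset.smul_sum, Pi.smul_apply]
  exact Finset.sum_congr rfl fun i _ => smul_comm _ _ _

theorem smul_mem_normSqSet_smul {V : Set E3} {N : ℕ} {c x : ℝ} (hc : c ≠ 0)
    (hx : x ∈ normSqSet V N) : c ^ 2 * x ∈ normSqSet (c • V) N := by
  obtain ⟨v, hinj, rfl, rfl⟩ := hx
  refine ⟨c • v, fun i j hij => hinj (smul_right_injective E3 hc hij), ?_, ?_⟩
  · exact Set.range_smul c v
  · rw [tupleAvg_smul, norm_smul, mul_pow, Real.norm_eq_abs, sq_abs]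

theorem IsGreatest.normSqSet_smul {V : Set E3} {N : ℕ} {c x : ℝ} (hc : c ≠ 0)
    (hx : IsGreatest (normSqSet V N) x) : IsGreatest (normSqSet (c • V) N) (c ^ 2 * x) := by
  refine ⟨smul_mem_normSqSet_smul hc hx.1, fun y hy => ?_⟩
  have h := hx.2 (inv_smul_smul₀ hc V ▸ smul_mem_normSqSet_smul (inv_ne_zero hc) hy)
  rwa [inv_pow, inv_mul_le_iff₀ (by positivity)] at h

theorem truncatedOctahedron_guesswork :
    IsGreatest (normSqSet truncatedOctahedron 24) 183440 ∧
    IsGreatest (normSqSet ((Real.sqrt 5)⁻¹ • truncatedOctahedron) 24) (183440 / 5) ∧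
    |(1 / 2 : ℝ) * (24 + 1 - Real.sqrt (183440 / 5) / 24) - 8.5096| < 0.0001 := by
  refine ⟨isGreatest_normSqSet_truncatedOctahedron, ?_, ?_⟩
  · have h := isGreatest_normSqSet_truncatedOctahedron.normSqSet_smul
      (c := (Real.sqrt 5)⁻¹) (by positivity)
    have h₅ : (Real.sqrt 5)⁻¹ ^ 2 * 183440 = 183440 / 5 := by
      rw [inv_pow, Real.sq_sqrt (by norm_num)]
      ring
    rwa [h₅] at h
  · have h₁ : (191.54 : ℝ) < Real.sqrt (183440 / 5) := Real.lt_sqrt_of_sq_lt (by norm_num)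
    have h₂ : Real.sqrt (183440 / 5) < 191.542 := by
      rw [Real.sqrt_lt' (by norm_num)]
      norm_num
    rw [abs_lt]
    constructor <;> linarith
end
end

section
/- Let 𝒱 ⊂ ℝ³ be the set of the N = 24 vertices of the rhombicuboctahedron: all vectors obtained as coordinate permutations of (±1,±1,±(1+√2)). Then max_{v ∈ 𝒱^N̲} |⟨v⟩|₂² = 146128 + 100128√2. Consequently, for the unit-normalized ensemble 𝒱/√(5+2√2) one has g = (146128 + 100128√2)/(5 + 2√2), and its minimum guesswork is (1/2)·(25 − √g/24) ≈ 8.5059. -/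
open Pointwise

noncomputable section

/-- The vertices of the rhombicuboctahedron: all coordinate permutations of
`(±1, ±1, ±(1 + √2))`. -/
def rhombicuboctahedron : Set E3 :=
  {v | ∃ σ : Equiv.Perm (Fin 3), ∃ s : Fin 3 → ℝ, (∀ i, s i = 1 ∨ s i = -1) ∧
       v = (WithLp.equiv 2 (Fin 3 → ℝ)).symm
             (fun i => s i * ![1, 1, 1 + Real.sqrt 2] (σ i))}

namespace Rhombicuboctahedron

/-! ### Sums over the vertex set -/

/-- The sum of `f` over the inner products of `(x, y, z)` with the 24 vertices. -/
def vertexSum (f : ℝ → ℝ) (x y z : ℝ) : ℝ :=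
  (fun g : ℝ → ℝ → ℝ → ℝ ↦ g x y z + g x y (-z) + g x (-y) z + g x (-y) (-z) +
    g (-x) y z + g (-x) y (-z) + g (-x) (-y) z + g (-x) (-y) (-z))
  fun x y z ↦ f (x + y + z + x * √2) + f (x + y + z + y * √2) + f (x + y + z + z * √2)

theorem vertexSum_neg_left (f : ℝ → ℝ) (x y z : ℝ) :
    vertexSum f (-x) y z = vertexSum f x y z := by
  simp only [vertexSum, neg_neg]
  ring

theorem vertexSum_swap_left (f : ℝ → ℝ) (x y z : ℝ) :
    vertexSum f y x z = vertexSum f x y z := by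
  simp only [vertexSum, add_comm y x, add_comm y (-x), add_comm (-y) x, add_comm (-y) (-x)]
  ring

theorem vertexSum_swap_right (f : ℝ → ℝ) (x y z : ℝ) :
    vertexSum f x z y = vertexSum f x y z := by
  simp only [vertexSum, add_right_comm _ z, add_right_comm _ (-z)]
  ring

/-- The sum of `|⟨u, p⟩ - ⟨u, q⟩|` over all ordered pairs of vertices, where `u = (x, y, z)`. -/
def spread (x y z : ℝ) : ℝ :=
  vertexSum (fun a ↦ vertexSum (fun b ↦ |a - b|) x y z) x y z

theorem spread_neg_left (x y z : ℝ) : spread (-x) y z = spread x y z := by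
  simp only [spread, vertexSum_neg_left]

theorem spread_swap_left (x y z : ℝ) : spread y x z = spread x y z := by
  unfold spread
  rw [vertexSum_swap_left]
  simp only [vertexSum_swap_left _ x y z]

theorem spread_swap_right (x y z : ℝ) : spread x z y = spread x y z := by
  unfold spread
  rw [vertexSum_swap_right]
  simp only [vertexSum_swap_right _ x y z]

/-- Labels of the vertices: the position of the long coordinate, and the signs. -/
abbrev Label := Fin 3 × Bool × Bool × Bool

def sgn (b : Bool) : ℤ := if b then 1 else -1

def signs (p : Label) : Fin 3 → ℤ := ![sgn p.2.1, sgn p.2.2.1, sgn p.2.2.2]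

/-- The vertex with a given label. -/
def vertex (p : Label) : E3 :=
  WithLp.toLp 2 fun i ↦ (signs p i : ℝ) + (if i = p.1 then (signs p i : ℝ) else 0) * √2

theorem inner_vertex (u : E3) (p : Label) :
    inner ℝ u (vertex p) = ∑ i, u i * ((signs p i : ℝ) +
      (if i = p.1 then (signs p i : ℝ) else 0) * √2) := by
  simp only [vertex, PiLp.inner_apply, RCLike.inner_apply, conj_trivial]
  exact Finset.sum_congr rfl fun i _ ↦ mul_comm _ _

theorem sum_inner_vertex (f : ℝ → ℝ) (u : E3) :
    ∑ p, f (inner ℝ u (vertex p)) = vertexSum f (u 0) (u 1) (u 2) := by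
  simp only [inner_vertex, Fintype.sum_prod_type, Fin.sum_univ_three, Fintype.sum_bool, signs,
    sgn, vertexSum]
  simp
  ring_nf

theorem signs_eq (p : Label) (i : Fin 3) : signs p i = 1 ∨ signs p i = -1 := by
  revert p i
  decide

theorem signs_surjective (s : Fin 3 → ℝ) (hs : ∀ i, s i = 1 ∨ s i = -1) (k : Fin 3) :
    ∃ p : Label, p.1 = k ∧ ∀ i, (signs p i : ℝ) = s i := by
  classical
  refine ⟨(k, decide (s 0 = 1), decide (s 1 = 1), decide (s 2 = 1)), rfl, fun i ↦ ?_⟩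
  have key (i) : ((sgn (decide (s i = 1)) : ℤ) : ℝ) = s i := by
    rcases hs i with h | h <;> rw [h] <;> norm_num [sgn]
  fin_cases i
  exacts [key 0, key 1, key 2]

theorem range_vertex : Set.range vertex = rhombicuboctahedron := by
  have coord (j : Fin 3) : (![1, 1, 1 + √2] j : ℝ) = 1 + if j = 2 then √2 else 0 := by
    fin_cases j <;> simp
  ext v
  constructor
  · rintro ⟨p, rfl⟩
    refine ⟨Equiv.swap p.1 2, fun i ↦ signs p i, fun i ↦ ?_, ?_⟩
    · rcases signs_eq p i with h | h <;> simp [h]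
    · ext i
      have h : Equiv.swap p.1 2 i = 2 ↔ i = p.1 := by
        rw [Equiv.swap_apply_eq_iff, Equiv.swap_apply_right]
      simp only [vertex, coord, h, WithLp.equiv_symm_apply]
      split_ifs <;> ring
  · rintro ⟨σ, s, hs, rfl⟩
    obtain ⟨p, hp, h⟩ := signs_surjective s hs (σ.symm 2)
    refine ⟨p, ?_⟩
    ext i
    simp only [vertex, coord, h, hp, WithLp.equiv_symm_apply, Equiv.eq_symm_apply]
    split_ifs <;> ring

theorem vertex_injective : Function.Injective vertex := by
  intro p q h
  have hne : Irrational √2 := irrational_sqrt_two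
  have key (a b c d : ℤ) (h : (a : ℝ) + b * √2 = c + d * √2) : a = c ∧ b = d := by
    have hbd : b = d := by
      by_contra hbd
      have hbd' : ((b - d : ℤ) : ℝ) ≠ 0 := by exact_mod_cast sub_ne_zero.2 hbd
      refine hne ⟨((c - a : ℤ) : ℚ) / ((b - d : ℤ) : ℚ), ?_⟩
      push_cast at hbd' ⊢
      rw [div_eq_iff hbd']
      linarith
    subst hbd
    exact ⟨by exact_mod_cast add_right_cancel h, rfl⟩
  have hcoord (i : Fin 3) : signs p i = signs q i ∧
      (if i = p.1 then signs p i else 0) = if i = q.1 then signs q i else 0 := by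
    apply key
    simpa [vertex] using congrArg (fun v : E3 ↦ v i) h
  clear h key
  revert p q
  decide +kernel

/-! ### Reduction to a bound on the spread -/

theorem sum_sign_sub (i : Fin 24) :
    ∑ j : Fin 24, ((Int.sign (i - j) : ℤ) : ℝ) = 2 * i - 23 := by
  have h : ∑ j : Fin 24, Int.sign ((i : ℕ) - (j : ℕ)) = 2 * (i : ℕ) - 23 := by
    revert i
    decide +kernel
  have hcast := congrArg (Int.cast : ℤ → ℝ) h
  push_cast at hcast
  exact hcast

/-- A form of the rearrangement inequality. -/
theorem two_mul_sum_le (a : Fin 24 → ℝ) :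
    2 * ∑ i : Fin 24, (2 * (i : ℝ) - 23) * a i ≤ ∑ i, ∑ j, |a i - a j| := by
  have h : 2 * ∑ i : Fin 24, (2 * (i : ℝ) - 23) * a i =
      ∑ i : Fin 24, ∑ j : Fin 24, ((Int.sign (i - j) : ℤ) : ℝ) * (a i - a j) := by
    simp only [mul_sub, Finset.sum_sub_distrib]
    rw [Finset.sum_comm (f := fun i j : Fin 24 ↦ ((Int.sign (i - j) : ℤ) : ℝ) * a j),
      two_mul, ← sub_neg_eq_add, ← Finset.sum_neg_distrib]
    congr 1 <;> refine Finset.sum_congr rfl fun i _ ↦ ?_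
    · rw [← Finset.sum_mul, sum_sign_sub]
    · rw [← Finset.sum_mul, ← sum_sign_sub, ← neg_mul, ← Finset.sum_neg_distrib]
      congr 1
      refine Finset.sum_congr rfl fun j _ ↦ ?_
      rw [← neg_sub (i : ℤ), Int.sign_neg, Int.cast_neg]
  rw [h]
  refine Finset.sum_le_sum fun i _ ↦ Finset.sum_le_sum fun j _ ↦ ?_
  refine (le_abs_self _).trans ?_
  rw [abs_mul]
  refine mul_le_of_le_one_left (abs_nonneg _) ?_
  rcases Int.sign_trichotomy (i - j) with h | h | h <;> simp [h]

theorem exists_equiv_of_range_eq {v : Fin 24 → E3} (hv : Function.Injective v)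
    (hr : Set.range v = rhombicuboctahedron) :
    ∃ e : Fin 24 ≃ Label, ∀ i, v i = vertex (e i) := by
  have h (i) : ∃ p, vertex p = v i := by
    rw [← Set.mem_range, range_vertex, ← hr]
    exact ⟨i, rfl⟩
  choose π hπ using h
  have hinj : Function.Injective π := fun i j hij ↦ hv (by rw [← hπ, ← hπ, hij])
  refine ⟨Equiv.ofBijective π ((Fintype.bijective_iff_injective_and_card π).2
    ⟨hinj, by simp⟩), fun i ↦ (hπ i).symm⟩

theorem two_mul_norm_sq_le_spread (e : Fin 24 ≃ Label) :
    2 * ‖tupleAvg 24 fun i ↦ vertex (e i)‖ ^ 2 ≤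
      spread (tupleAvg 24 (fun i ↦ vertex (e i)) 0) (tupleAvg 24 (fun i ↦ vertex (e i)) 1)
        (tupleAvg 24 (fun i ↦ vertex (e i)) 2) := by
  set w := tupleAvg 24 fun i ↦ vertex (e i) with hw
  have hsum (f : ℝ → ℝ) :
      ∑ i, f (inner ℝ w (vertex (e i))) = vertexSum f (w 0) (w 1) (w 2) := by
    rw [← sum_inner_vertex, ← Equiv.sum_comp e]
  have hzero : ∑ i, inner ℝ w (vertex (e i)) = 0 := by
    rw [hsum fun a ↦ a, vertexSum]
    ring
  have hnorm : ‖w‖ ^ 2 = ∑ i : Fin 24, (2 * (i : ℝ) - 23) * inner ℝ w (vertex (e i)) := by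
    have h : ‖w‖ ^ 2 = ∑ i : Fin 24, (2 * (i : ℝ) + 3 - 24) * inner ℝ w (vertex (e i)) := by
      rw [← real_inner_self_eq_norm_sq]
      nth_rewrite 2 [hw]
      simp [tupleAvg, inner_sum, inner_smul_right]
    rw [h, ← sub_eq_zero, ← Finset.sum_sub_distrib, ← mul_zero (2 : ℝ), ← hzero, Finset.mul_sum]
    refine Finset.sum_congr rfl fun i _ ↦ ?_
    ring
  rw [hnorm]
  refine (two_mul_sum_le _).trans (le_of_eq ?_)
  rw [Finset.sum_congr rfl fun i _ ↦ hsum fun b ↦ |inner ℝ w (vertex (e i)) - b|]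
  exact hsum fun a ↦ vertexSum (fun b ↦ |a - b|) (w 0) (w 1) (w 2)

/-! ### A checker for the bound on the spread

The cone `x ≥ y ≥ z ≥ 0` is triangulated into cones with integral generators. The spread is convex,
so on each of these cones it is at most any linear functional that dominates it at the generators;
it remains to bound the norm of that functional. -/

/-- The real number represented by an element of `ℤ[√2]`. -/
def toReal (a : ℤ√2) : ℝ := a.re + a.im * √2

theorem toReal_add (a b : ℤ√2) : toReal (a + b) = toReal a + toReal b := by
  simp [toReal]
  ring

theorem toReal_sub (a b : ℤ√2) : toReal (a - b) = toReal a - toReal b := by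
  simp [toReal]
  ring

theorem toReal_mul (a b : ℤ√2) : toReal (a * b) = toReal a * toReal b := by
  simp [toReal]
  ring_nf
  rw [Real.sq_sqrt zero_le_two]

theorem toReal_intCast (n : ℤ) : toReal n = n := by
  simp [toReal]

def IsNonneg (a : ℤ√2) : Prop :=
  0 ≤ a.re ∧ 0 ≤ a.im ∨ 0 ≤ a.re ∧ 2 * (a.im * a.im) ≤ a.re * a.re ∨
    0 ≤ a.im ∧ a.re * a.re ≤ 2 * (a.im * a.im)

instance (a : ℤ√2) : Decidable (IsNonneg a) := by
  unfold IsNonneg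
  infer_instance

theorem IsNonneg.toReal_nonneg {a : ℤ√2} (h : IsNonneg a) : 0 ≤ toReal a := by
  have h2 : √2 * √2 = 2 := Real.mul_self_sqrt zero_le_two
  have h0 : 0 ≤ √2 := Real.sqrt_nonneg 2
  unfold toReal
  rcases h with ⟨h, h'⟩ | ⟨h, h'⟩ | ⟨h, h'⟩
  · have h : (0 : ℝ) ≤ a.re := by exact_mod_cast h
    have h' : (0 : ℝ) ≤ a.im := by exact_mod_cast h'
    positivity
  · have h : (0 : ℝ) ≤ a.re := by exact_mod_cast h
    have h' : (2 : ℝ) * (a.im * a.im) ≤ a.re * a.re := by exact_mod_cast h'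
    have := abs_le_of_sq_le_sq' (a := a.im * √2) (b := a.re) (by nlinarith) h
    linarith
  · have h : (0 : ℝ) ≤ a.im * √2 := mul_nonneg (by exact_mod_cast h) h0
    have h' : (a.re : ℝ) * a.re ≤ 2 * (a.im * a.im) := by exact_mod_cast h'
    have := abs_le_of_sq_le_sq' (a := (a.re : ℝ)) (b := a.im * √2) (by nlinarith) h
    linarith

/-- An upper bound for the absolute value, which is attained. -/
def absBound (a : ℤ√2) : ℤ√2 :=
  if IsNonneg a then a else if IsNonneg ⟨-a.re, -a.im⟩ then ⟨-a.re, -a.im⟩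
    else ⟨|a.re| + 2 * |a.im|, 0⟩

theorem abs_toReal_le (a : ℤ√2) : |toReal a| ≤ toReal (absBound a) := by
  unfold absBound
  split_ifs with h h
  · rw [abs_of_nonneg h.toReal_nonneg]
  · have hn : toReal ⟨-a.re, -a.im⟩ = -toReal a := by
      simp [toReal]
      ring
    rw [hn, ← abs_neg, abs_of_nonneg]
    exact hn ▸ h.toReal_nonneg
  · have h2 : √2 ≤ 2 := Real.sqrt_le_iff.2 (by norm_num)
    simp only [toReal, Int.cast_add, Int.cast_mul, Int.cast_abs, Int.cast_ofNat, Int.cast_zero,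
      zero_mul, add_zero]
    refine (abs_add_le _ _).trans ?_
    rw [abs_mul, abs_of_nonneg (Real.sqrt_nonneg 2), mul_comm (2 : ℝ)]
    gcongr

/-- The inner products of `(x, y, z)` with the vertices. -/
def vertexList (x y z : ℤ) : List (ℤ√2) :=
  [x, -x].flatMap fun x ↦ [y, -y].flatMap fun y ↦ [z, -z].flatMap fun z ↦
    [⟨x + y + z, x⟩, ⟨x + y + z, y⟩, ⟨x + y + z, z⟩]

theorem sum_map_vertexList (f : ℝ → ℝ) (x y z : ℤ) :
    ((vertexList x y z).map fun a ↦ f (toReal a)).sum = vertexSum f x y z := by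
  simp only [vertexList, vertexSum, toReal, List.flatMap_cons, List.flatMap_nil, List.map_append,
    List.sum_append, List.map_cons, List.map_nil, List.sum_cons, List.sum_nil, List.append_nil]
  push_cast
  ring

/-- An upper bound for the sum of `f` over a list. -/
def listSum (f : ℤ√2 → ℤ√2) : List (ℤ√2) → ℤ√2
  | [] => ⟨0, 0⟩
  | a :: l => ⟨(f a).re + (listSum f l).re, (f a).im + (listSum f l).im⟩

theorem toReal_listSum (f : ℤ√2 → ℤ√2) (l : List (ℤ√2)) :
    toReal (listSum f l) = (l.map fun a ↦ toReal (f a)).sum := by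
  induction l with
  | nil => simp [listSum, toReal]
  | cons a l ih =>
    rw [List.map_cons, List.sum_cons, ← ih]
    simp [listSum, toReal]
    ring

def spreadBound (x y z : ℤ) : ℤ√2 :=
  (fun l ↦ listSum (fun a ↦ listSum (fun b ↦ absBound ⟨a.re - b.re, a.im - b.im⟩) l) l)
    (vertexList x y z)

theorem spread_le_spreadBound (x y z : ℤ) : spread x y z ≤ toReal (spreadBound x y z) := by
  simp only [spread, spreadBound, ← sum_map_vertexList, toReal_listSum]
  refine List.sum_le_sum fun a _ ↦ List.sum_le_sum fun b _ ↦ ?_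
  rw [← toReal_sub]
  exact abs_toReal_le (a - b)

/-- An integral vector together with a bound for its spread. -/
structure Ray where
  (x y z : ℤ)
  bound : ℤ√2

def Ray.IsValid (r : Ray) : Prop := IsNonneg (r.bound - spreadBound r.x r.y r.z)

instance (r : Ray) : Decidable r.IsValid := by
  unfold Ray.IsValid
  infer_instance

theorem Ray.IsValid.spread_le {r : Ray} (h : r.IsValid) :
    spread r.x r.y r.z ≤ toReal r.bound := by
  have := IsNonneg.toReal_nonneg h
  rw [toReal_sub] at this
  linarith [spread_le_spreadBound r.x r.y r.z]

/-- The squared norm to be shown maximal. -/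
def maxNormSq : ℤ√2 := ⟨146128, 100128⟩

/-- Certificates for the bound on the spread on a triangular cone. -/
inductive Certificate
  /-- `(a, b, c) / 10000` defines a linear functional that dominates half of the spread. -/
  | leaf (a b c : ℤ√2)
  /-- Permute the generators cyclically. -/
  | rotate (t : Certificate)
  /-- Subdivide the cone by a combination of the first two generators. -/
  | split (m n : ℤ) (r : Ray) (t₁ t₂ : Certificate)

def Ray.IsDominated (a b c : ℤ√2) (r : Ray) : Prop :=
  IsNonneg (2 * (a * r.x + b * r.y + c * r.z) - 10000 * r.bound)

instance (a b c : ℤ√2) (r : Ray) : Decidable (r.IsDominated a b c) := by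
  unfold Ray.IsDominated
  infer_instance

def Certificate.check : Certificate → Ray → Ray → Ray → Bool
  | leaf a b c, r₁, r₂, r₃ =>
    decide (r₁.IsDominated a b c) && decide (r₂.IsDominated a b c) &&
      decide (r₃.IsDominated a b c) &&
      decide (IsNonneg (10000 * 10000 * maxNormSq - (a * a + b * b + c * c)))
  | rotate t, r₁, r₂, r₃ => t.check r₂ r₃ r₁
  | split m n r t₁ t₂, r₁, r₂, r₃ =>
    decide (0 < m) && decide (0 < n) && decide r.IsValid &&
      decide (r.x = m * r₁.x + n * r₂.x) && decide (r.y = m * r₁.y + n * r₂.y) &&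
      decide (r.z = m * r₁.z + n * r₂.z) && t₁.check r₁ r r₃ && t₂.check r r₂ r₃

/-- The bound on the spread on the cone generated by three rays. -/
def BoundOn (r₁ r₂ r₃ : Ray) : Prop :=
  ∀ α β γ : ℝ, 0 ≤ α → 0 ≤ β → 0 ≤ γ → ∀ x y z : ℝ, x = α * r₁.x + β * r₂.x + γ * r₃.x →
    y = α * r₁.y + β * r₂.y + γ * r₃.y → z = α * r₁.z + β * r₂.z + γ * r₃.z →
      spread x y z ^ 2 ≤ 4 * toReal maxNormSq * (x ^ 2 + y ^ 2 + z ^ 2)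

theorem spread_nonneg (x y z : ℝ) : 0 ≤ spread x y z := by
  unfold spread vertexSum
  positivity

theorem spread_eq_sum (u : E3) : spread (u 0) (u 1) (u 2) =
    ∑ p, ∑ q, |inner ℝ u (vertex p) - inner ℝ u (vertex q)| := by
  rw [Finset.sum_congr rfl fun p _ ↦ sum_inner_vertex (fun b ↦ |inner ℝ u (vertex p) - b|) u]
  exact (sum_inner_vertex (fun a ↦ vertexSum (fun b ↦ |a - b|) (u 0) (u 1) (u 2)) u).symm

theorem spread_add_le (x y z x' y' z' : ℝ) :
    spread (x + x') (y + y') (z + z') ≤ spread x y z + spread x' y' z' := by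
  have h (u v : E3) : spread ((u + v) 0) ((u + v) 1) ((u + v) 2) ≤
      spread (u 0) (u 1) (u 2) + spread (v 0) (v 1) (v 2) := by
    simp only [spread_eq_sum, ← Finset.sum_add_distrib]
    refine Finset.sum_le_sum fun p _ ↦ Finset.sum_le_sum fun q _ ↦ ?_
    rw [inner_add_left, inner_add_left, add_sub_add_comm]
    exact abs_add_le _ _
  exact h !₂[x, y, z] !₂[x', y', z']

theorem spread_mul {t : ℝ} (ht : 0 ≤ t) (x y z : ℝ) :
    spread (t * x) (t * y) (t * z) = t * spread x y z := by
  have h (u : E3) : spread ((t • u) 0) ((t • u) 1) ((t • u) 2) =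
      t * spread (u 0) (u 1) (u 2) := by
    simp only [spread_eq_sum, Finset.mul_sum]
    refine Finset.sum_congr rfl fun p _ ↦ Finset.sum_congr rfl fun q _ ↦ ?_
    rw [real_inner_smul_left, real_inner_smul_left, ← mul_sub, abs_mul, abs_of_nonneg ht]
  exact h !₂[x, y, z]

theorem boundOn_of_isDominated {a b c : ℤ√2} {r₁ r₂ r₃ : Ray} (v₁ : r₁.IsValid) (v₂ : r₂.IsValid)
    (v₃ : r₃.IsValid) (h₁ : r₁.IsDominated a b c) (h₂ : r₂.IsDominated a b c)
    (h₃ : r₃.IsDominated a b c)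
    (h : IsNonneg (10000 * 10000 * maxNormSq - (a * a + b * b + c * c))) :
    BoundOn r₁ r₂ r₃ := by
  rintro α β γ hα hβ hγ x y z hx hy hz
  have hk : toReal 10000 = 10000 := by exact_mod_cast toReal_intCast 10000
  have h2 : toReal 2 = 2 := by exact_mod_cast toReal_intCast 2
  have key {r : Ray} (v : r.IsValid) (h : r.IsDominated a b c) :
      10000 * spread r.x r.y r.z ≤
        2 * (toReal a * r.x + toReal b * r.y + toReal c * r.z) := by
    have := h.toReal_nonneg
    simp only [toReal_sub, toReal_mul, toReal_add, toReal_intCast, hk, h2] at this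
    linarith [v.spread_le]
  have hs : spread x y z ≤
      α * spread r₁.x r₁.y r₁.z + β * spread r₂.x r₂.y r₂.z + γ * spread r₃.x r₃.y r₃.z := by
    rw [hx, hy, hz, ← spread_mul hα, ← spread_mul hβ, ← spread_mul hγ]
    exact (spread_add_le _ _ _ _ _ _).trans (by gcongr; exact spread_add_le _ _ _ _ _ _)
  have hl : 10000 * spread x y z ≤ 2 * (toReal a * x + toReal b * y + toReal c * z) := by
    refine (mul_le_mul_of_nonneg_left hs (by norm_num)).trans ?_
    rw [hx, hy, hz]
    linarith [mul_le_mul_of_nonneg_left (key v₁ h₁) hα, mul_le_mul_of_nonneg_left (key v₂ h₂) hβ,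
      mul_le_mul_of_nonneg_left (key v₃ h₃) hγ]
  have hn := h.toReal_nonneg
  simp only [toReal_sub, toReal_mul, toReal_add, hk] at hn
  have hcs : (toReal a * x + toReal b * y + toReal c * z) ^ 2 ≤
      (toReal a ^ 2 + toReal b ^ 2 + toReal c ^ 2) * (x ^ 2 + y ^ 2 + z ^ 2) := by
    linarith [sq_nonneg (toReal a * y - toReal b * x), sq_nonneg (toReal b * z - toReal c * y),
      sq_nonneg (toReal a * z - toReal c * x)]
  have hsq := pow_le_pow_left₀ (mul_nonneg (by norm_num) (spread_nonneg x y z)) hl 2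
  have hm : (toReal a ^ 2 + toReal b ^ 2 + toReal c ^ 2) * (x ^ 2 + y ^ 2 + z ^ 2) ≤
      (10000 * 10000 * toReal maxNormSq) * (x ^ 2 + y ^ 2 + z ^ 2) :=
    mul_le_mul_of_nonneg_right (by linarith) (by positivity)
  linarith

theorem boundOn_of_split {m n : ℤ} {r r₁ r₂ r₃ : Ray} (hm : 0 < m) (hn : 0 < n)
    (hx : r.x = m * r₁.x + n * r₂.x) (hy : r.y = m * r₁.y + n * r₂.y)
    (hz : r.z = m * r₁.z + n * r₂.z) (h₁ : BoundOn r₁ r r₃) (h₂ : BoundOn r r₂ r₃) :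
    BoundOn r₁ r₂ r₃ := by
  rintro α β γ hα hβ hγ x y z rfl rfl rfl
  have hm : (0 : ℝ) < m := by exact_mod_cast hm
  have hn : (0 : ℝ) < n := by exact_mod_cast hn
  rcases le_total (m * β) (n * α) with h | h
  · refine h₁ (α - m * (β / n)) (β / n) γ ?_ (by positivity) hγ _ _ _ ?_ ?_ ?_
    · rw [sub_nonneg, mul_div_assoc', div_le_iff₀ hn]
      linarith
    all_goals
      simp only [hx, hy, hz, Int.cast_add, Int.cast_mul]
      field_simp
      ring
  · refine h₂ (α / m) (β - n * (α / m)) γ (by positivity) ?_ hγ _ _ _ ?_ ?_ ?_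
    · rw [sub_nonneg, mul_div_assoc', div_le_iff₀ hm]
      linarith
    all_goals
      simp only [hx, hy, hz, Int.cast_add, Int.cast_mul]
      field_simp
      ring

theorem Certificate.boundOn_of_check (t : Certificate) {r₁ r₂ r₃ : Ray} (v₁ : r₁.IsValid)
    (v₂ : r₂.IsValid) (v₃ : r₃.IsValid) (h : t.check r₁ r₂ r₃) : BoundOn r₁ r₂ r₃ := by
  induction t generalizing r₁ r₂ r₃ with
  | leaf a b c =>
    simp only [check, Bool.and_eq_true, decide_eq_true_eq] at h
    obtain ⟨⟨⟨h₁, h₂⟩, h₃⟩, h⟩ := h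
    exact boundOn_of_isDominated v₁ v₂ v₃ h₁ h₂ h₃ h
  | rotate t ih =>
    intro α β γ hα hβ hγ x y z hx hy hz
    exact ih v₂ v₃ v₁ h β γ α hβ hγ hα x y z (by rw [hx]; ring) (by rw [hy]; ring)
      (by rw [hz]; ring)
  | split m n r t₁ t₂ ih₁ ih₂ =>
    simp only [check, Bool.and_eq_true, decide_eq_true_eq] at h
    obtain ⟨⟨⟨⟨⟨⟨⟨hm, hn⟩, v⟩, hx⟩, hy⟩, hz⟩, h₁⟩, h₂⟩ := h
    exact boundOn_of_split hm hn hx hy hz (ih₁ v₁ v v₃ h₁) (ih₂ v v₂ v₃ h₂)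

/-- The functional given by one of the two maximizers in the cone `x ≥ y ≥ z ≥ 0`. -/
def maximizer₁ : Certificate :=
  .leaf ⟨2440000, 1360000⟩ ⟨1720000, 920000⟩ ⟨440000, 240000⟩

/-- The functional given by the other maximizer in the cone `x ≥ y ≥ z ≥ 0`. -/
def maximizer₂ : Certificate :=
  .leaf ⟨2360000, 1280000⟩ ⟨1480000, 840000⟩ ⟨1160000, 640000⟩

/-- A certificate for the cone `x ≥ y ≥ z ≥ 0`. -/
def certificate : Certificate :=
  .rotate <| .rotate <| .split 2 3 ⟨5, 2, 2, ⟨3456, 1872⟩⟩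
    (.rotate <| .rotate <| .split 1 1 ⟨2, 2, 1, ⟨1784, 1000⟩⟩
       (.rotate <| .rotate <| .split 1 3 ⟨8, 5, 2, ⟨5848, 3168⟩⟩
          (.rotate <| .rotate <| .split 2 1 ⟨9, 6, 4, ⟨6952, 3824⟩⟩
             (.rotate <| .rotate <| .split 1 3 ⟨14, 11, 5, ⟨11056, 6160⟩⟩
                (.rotate <| .rotate <| .split 1 1 ⟨17, 11, 6, ⟨12736, 7000⟩⟩
                   (.leaf ⟨4221668, 0⟩ ⟨2850997, 0⟩ ⟨1674694, 0⟩)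
                   (.leaf ⟨4328992, 0⟩ ⟨2860754, 0⟩ ⟨1352723, 0⟩))
                (.rotate <| .split 1 1 ⟨11, 8, 5, ⟨8768, 4776⟩⟩
                   (.leaf ⟨3937119, 0⟩ ⟨3140519, 0⟩ ⟨1835793, 0⟩)
                   (.leaf ⟨4153942, 0⟩ ⟨2904210, 0⟩ ⟨1747258, 0⟩)))
             (.rotate <| .rotate <| .split 1 2 ⟨26, 17, 10, ⟨19672, 10816⟩⟩
                (.rotate <| .rotate <| .split 1 1 ⟨13, 7, 4, ⟨9312, 5000⟩⟩
                   (.rotate <| .rotate <| .split 1 1 ⟨31, 19, 12, ⟨22960, 12776⟩⟩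
                      (.leaf ⟨4403874, 0⟩ ⟨2645001, 0⟩ ⟨1537495, 0⟩)
                      (.leaf ⟨4447536, 0⟩ ⟨2512885, 0⟩ ⟨1626796, 0⟩))
                   (.split 1 1 ⟨21, 12, 6, ⟨15048, 8232⟩⟩
                      (.leaf ⟨4403723, 0⟩ ⟨2646959, 0⟩ ⟨1534559, 0⟩)
                      (.leaf ⟨4359312, 0⟩ ⟨2791836, 0⟩ ⟨1403737, 0⟩)))
                (.rotate <| .split 1 1 ⟨14, 8, 6, ⟨10464, 5632⟩⟩
                   (.leaf ⟨4273440, 0⟩ ⟨2692111, 0⟩ ⟨1796535, 0⟩)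
                   (.rotate <| .split 1 1 ⟨31, 19, 12, ⟨22960, 12776⟩⟩
                      (.leaf ⟨4408920, 0⟩ ⟨2518402, 0⟩ ⟨1717821, 0⟩)
                      (.leaf ⟨4313069, 0⟩ ⟨2663291, 0⟩ ⟨1742496, 0⟩)))))
          (.rotate <| .split 3 2 ⟨7, 7, 2, ⟨6064, 3328⟩⟩
             (.rotate <| .rotate <| .split 1 3 ⟨11, 8, 2, ⟨8296, 4560⟩⟩
                (.rotate <| .rotate <| .split 1 2 ⟨23, 17, 6, ⟨17696, 9624⟩⟩
                   (.rotate <| .rotate <| .split 1 1 ⟨18, 15, 4, ⟨14248, 7912⟩⟩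
                      (.leaf ⟨4278960, 0⟩ ⟨3121523, 0⟩ ⟨841669, 0⟩)
                      (.leaf ⟨4083241, 0⟩ ⟨3298017, 0⟩ ⟨1091857, 0⟩))
                   (.rotate <| .split 1 1 ⟨19, 13, 4, ⟨14096, 7752⟩⟩
                      (.leaf ⟨4355520, 0⟩ ⟨2982025, 0⟩ ⟨943432, 0⟩)
                      (.leaf ⟨4316468, 0⟩ ⟨3067940, 0⟩ ⟨849706, 0⟩)))
                (.split 1 2 ⟨13, 10, 2, ⟨9880, 5536⟩⟩
                   (.rotate <| .rotate <| .split 1 1 ⟨18, 15, 4, ⟨14248, 7912⟩⟩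
                      (.leaf ⟨4089824, 0⟩ ⟨3384659, 0⟩ ⟨765570, 0⟩)
                      (.leaf ⟨4282859, 0⟩ ⟨3130417, 0⟩ ⟨784649, 0⟩))
                   (.leaf ⟨4076468, 0⟩ ⟨3411371, 0⟩ ⟨718823, 0⟩)))
             (.rotate <| .split 2 1 ⟨12, 9, 4, ⟨9288, 5176⟩⟩
                (.leaf ⟨3928484, 0⟩ ⟨3361643, 0⟩ ⟨1410816, 0⟩)
                (.rotate <| .split 1 1 ⟨15, 12, 4, ⟨11688, 6584⟩⟩
                   (.leaf ⟨4299660, 0⟩ ⟨3006643, 0⟩ ⟨1105330, 0⟩)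
                   (.leaf ⟨3996507, 0⟩ ⟨3334434, 0⟩ ⟨1267968, 0⟩)))))
       (.rotate <| .rotate <| .split 1 3 ⟨11, 8, 5, ⟨8768, 4776⟩⟩
          (.rotate <| .rotate <| .split 3 1 ⟨8, 5, 5, ⟨6480, 3488⟩⟩
             (.rotate <| .rotate <| .split 1 3 ⟨14, 11, 8, ⟨11928, 6360⟩⟩
                (.rotate <| .rotate <| .split 1 1 ⟨19, 13, 10, ⟨15136, 8328⟩⟩
                   (.leaf ⟨3961283, 0⟩ ⟨2852080, 0⟩ ⟨2222647, 0⟩)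
                   (.leaf ⟨3985161, 0⟩ ⟨2899836, 0⟩ ⟨2115195, 0⟩))
                (.leaf ⟨3833070, 0⟩ ⟨2903365, 0⟩ ⟨2376502, 0⟩))
             (.rotate <| .split 3 2 ⟨37, 22, 16, ⟨27688, 15216⟩⟩
                (.split 1 1 ⟨42, 24, 18, ⟨31392, 16896⟩⟩
                   (.leaf ⟨4273048, 0⟩ ⟨2433093, 0⟩ ⟨2142810, 0⟩)
                   (.leaf ⟨4219882, 0⟩ ⟨2553715, 0⟩ ⟨2107252, 0⟩))
                (.rotate <| .split 1 1 ⟨19, 13, 10, ⟨15136, 8328⟩⟩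
                   (.leaf ⟨4159780, 0⟩ ⟨2725217, 0⟩ ⟨2010424, 0⟩)
                   (.split 1 2 ⟨35, 23, 20, ⟨27968, 15384⟩⟩
                      maximizer₂
                      (.leaf ⟨4203223, 0⟩ ⟨2585368, 0⟩ ⟨2102254, 0⟩)))))
          (.rotate <| .rotate <| .split 3 1 ⟨14, 11, 8, ⟨11928, 6360⟩⟩
             (.split 1 1 ⟨15, 12, 9, ⟨12960, 6912⟩⟩
                (.leaf ⟨3674803, 0⟩ ⟨3203331, 0⟩ ⟨2234803, 0⟩)
                (.leaf ⟨3774214, 0⟩ ⟨3153625, 0⟩ ⟨2135392, 0⟩))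
             (.leaf ⟨3879279, 0⟩ ⟨3111599, 0⟩ ⟨2009314, 0⟩))))
    (.rotate <| .split 3 2 ⟨5, 2, 0, ⟨3200, 1792⟩⟩
       (.rotate <| .rotate <| .split 1 3 ⟨8, 2, 2, ⟨5088, 2816⟩⟩
          (.rotate <| .rotate <| .split 1 1 ⟨10, 4, 2, ⟨6624, 3584⟩⟩
             (.rotate <| .rotate <| .split 1 1 ⟨13, 4, 2, ⟨8256, 4576⟩⟩
                (.leaf ⟨5058167, 0⟩ ⟨1497124, 0⟩ ⟨946275, 0⟩)
                (.leaf ⟨5058167, 0⟩ ⟨1690261, 0⟩ ⟨560001, 0⟩))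
             (.leaf ⟨4945030, 0⟩ ⟨1610261, 0⟩ ⟨1285686, 0⟩))
          (.rotate <| .rotate <| .split 3 2 ⟨31, 10, 4, ⟨19648, 10944⟩⟩
             (.leaf ⟨5142742, 0⟩ ⟨1478823, 0⟩ ⟨353138, 0⟩)
             (.split 1 1 ⟨39, 12, 6, ⟨24768, 13728⟩⟩
                (.leaf ⟨5142742, 0⟩ ⟨1356313, 0⟩ ⟨678157, 0⟩)
                (.leaf ⟨5142742, 0⟩ ⟨1285686, 0⟩ ⟨819412, 0⟩))))
       (.rotate <| .split 3 1 ⟨8, 5, 2, ⟨5848, 3168⟩⟩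
          (.rotate <| .rotate <| .split 1 3 ⟨8, 5, 0, ⟨5440, 3264⟩⟩
             (.rotate <| .rotate <| .split 1 1 ⟨13, 7, 2, ⟨8944, 4952⟩⟩
                (.rotate <| .rotate <| .split 1 1 ⟨16, 10, 2, ⟨11552, 6208⟩⟩
                   (.leaf ⟨4581511, 0⟩ ⟨2725578, 0⟩ ⟨548630, 0⟩)
                   (.leaf ⟨4495825, 0⟩ ⟨2809891, 0⟩ ⟨812549, 0⟩))
                (.leaf ⟨4755205, 0⟩ ⟨2447667, 0⟩ ⟨392305, 0⟩))
             (.rotate <| .split 3 1 ⟨11, 8, 2, ⟨8296, 4560⟩⟩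
                (.split 3 1 ⟨14, 11, 2, ⟨10712, 6000⟩⟩
                   (.leaf ⟨4280258, 0⟩ ⟨3207581, 0⟩ ⟨389706, 0⟩)
                   (.rotate <| .split 1 1 ⟨19, 13, 2, ⟨13952, 7640⟩⟩
                      (.leaf ⟨4318331, 0⟩ ⟨3102449, 0⟩ ⟨701422, 0⟩)
                      (.leaf ⟨4302376, 0⟩ ⟨3172193, 0⟩ ⟨429518, 0⟩)))
                (.rotate <| .split 3 2 ⟨40, 25, 6, ⟨28960, 15568⟩⟩
                   (.rotate <| .rotate <| .split 1 1 ⟨19, 13, 4, ⟨14096, 7752⟩⟩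
                      (.rotate <| .rotate <| .split 1 2 ⟨62, 41, 10, ⟨45240, 24888⟩⟩
                         (.leaf ⟨4425162, 0⟩ ⟨2918300, 0⟩ ⟨819738, 0⟩)
                         maximizer₁)
                      (.leaf ⟨4430586, 0⟩ ⟨2906959, 0⟩ ⟨830833, 0⟩))
                   (.rotate <| .split 1 1 ⟨19, 13, 2, ⟨13952, 7640⟩⟩
                      (.leaf ⟨4503225, 0⟩ ⟨2850834, 0⟩ ⟨580427, 0⟩)
                      (.rotate <| .split 2 1 ⟨62, 41, 10, ⟨45240, 24888⟩⟩
                         (.leaf ⟨4361595, 0⟩ ⟨3033227, 0⟩ ⟨740359, 0⟩)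
                         (.leaf ⟨4431923, 0⟩ ⟨2936526, 0⟩ ⟨700800, 0⟩))))))
          (.rotate <| .split 3 2 ⟨25, 10, 6, ⟨16712, 9024⟩⟩
             (.rotate <| .rotate <| .split 1 1 ⟨13, 7, 4, ⟨9312, 5000⟩⟩
                (.rotate <| .rotate <| .split 1 1 ⟨33, 15, 8, ⟨22544, 12120⟩⟩
                   (.leaf ⟨4661802, 0⟩ ⟨2287202, 0⟩ ⟨1325379, 0⟩)
                   (.leaf ⟨4578059, 0⟩ ⟨2544258, 0⟩ ⟨1147696, 0⟩))
                (.leaf ⟨4661802, 0⟩ ⟨2287202, 0⟩ ⟨1325379, 0⟩))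
             (.rotate <| .split 3 2 ⟨31, 16, 4, ⟨21296, 11496⟩⟩
                (.rotate <| .rotate <| .split 1 1 ⟨30, 12, 6, ⟨19872, 10752⟩⟩
                   (.leaf ⟨4798920, 0⟩ ⟨2221958, 0⟩ ⟨862792, 0⟩)
                   (.leaf ⟨4871315, 0⟩ ⟨2157390, 0⟩ ⟨560001, 0⟩))
                (.rotate <| .split 1 1 ⟨33, 15, 8, ⟨22544, 12120⟩⟩
                   (.leaf ⟨4612027, 0⟩ ⟨2551052, 0⟩ ⟨994836, 0⟩)
                   (.leaf ⟨4798920, 0⟩ ⟨2221958, 0⟩ ⟨862792, 0⟩))))))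

theorem boundOn_chamber :
    BoundOn ⟨1, 0, 0, ⟨576, 320⟩⟩ ⟨1, 1, 0, ⟨864, 448⟩⟩ ⟨1, 1, 1, ⟨1008, 576⟩⟩ :=
  certificate.boundOn_of_check (by decide +kernel) (by decide +kernel) (by decide +kernel)
    (by decide +kernel)

theorem spread_abs_left (x y z : ℝ) : spread |x| y z = spread x y z := by
  rcases abs_choice x with h | h <;> rw [h]
  exact spread_neg_left x y z

theorem spread_abs (x y z : ℝ) : spread |x| |y| |z| = spread x y z := by
  rw [spread_abs_left, ← spread_swap_left, spread_abs_left, ← spread_swap_left,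
    ← spread_swap_right, ← spread_swap_left, spread_abs_left, spread_swap_left, spread_swap_right]

theorem spread_sq_le_of_chamber {x y z : ℝ} (hz : 0 ≤ z) (hy : z ≤ y) (hx : y ≤ x) :
    spread x y z ^ 2 ≤ 4 * toReal maxNormSq * (x ^ 2 + y ^ 2 + z ^ 2) := by
  refine boundOn_chamber (x - y) (y - z) z (sub_nonneg.2 hx) (sub_nonneg.2 hy) hz x y z ?_ ?_ ?_ <;>
  · push_cast
    ring

theorem spread_sq_le (x y z : ℝ) :
    spread x y z ^ 2 ≤ 4 * toReal maxNormSq * (x ^ 2 + y ^ 2 + z ^ 2) := by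
  rw [← spread_abs, ← sq_abs x, ← sq_abs y, ← sq_abs z]
  have hx := abs_nonneg x
  have hy := abs_nonneg y
  have hz := abs_nonneg z
  generalize |x| = x at *
  generalize |y| = y at *
  generalize |z| = z at *
  have swap {x y z : ℝ} (h : spread x y z ^ 2 ≤ 4 * toReal maxNormSq * (x ^ 2 + y ^ 2 + z ^ 2)) :
      spread y x z ^ 2 ≤ 4 * toReal maxNormSq * (y ^ 2 + x ^ 2 + z ^ 2) := by
    rwa [spread_swap_left, add_comm (y ^ 2)]
  have swap' {x y z : ℝ} (h : spread x y z ^ 2 ≤ 4 * toReal maxNormSq * (x ^ 2 + y ^ 2 + z ^ 2)) :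
      spread x z y ^ 2 ≤ 4 * toReal maxNormSq * (x ^ 2 + z ^ 2 + y ^ 2) := by
    rwa [spread_swap_right, add_right_comm]
  rcases le_total x y with hxy | hxy <;> rcases le_total y z with hyz | hyz <;>
    rcases le_total x z with hxz | hxz
  · exact swap (swap' (swap (spread_sq_le_of_chamber hx hxy hyz)))
  · exact swap (swap' (swap (spread_sq_le_of_chamber hx hxy hyz)))
  · exact swap (swap' (spread_sq_le_of_chamber hx hxz hyz))
  · exact swap (spread_sq_le_of_chamber hz hxz hxy)
  · exact swap' (swap (spread_sq_le_of_chamber hy hxy hxz))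
  · exact swap' (spread_sq_le_of_chamber hy hyz hxz)
  · exact spread_sq_le_of_chamber hz hyz hxy
  · exact spread_sq_le_of_chamber hz hyz hxy

theorem norm_tupleAvg_sq_le (e : Fin 24 ≃ Label) :
    ‖tupleAvg 24 fun i ↦ vertex (e i)‖ ^ 2 ≤ toReal maxNormSq := by
  have h₁ := two_mul_norm_sq_le_spread e
  have h₂ := spread_sq_le (tupleAvg 24 (fun i ↦ vertex (e i)) 0)
    (tupleAvg 24 (fun i ↦ vertex (e i)) 1) (tupleAvg 24 (fun i ↦ vertex (e i)) 2)
  have h₃ : ‖tupleAvg 24 fun i ↦ vertex (e i)‖ ^ 2 = _ := EuclideanSpace.real_norm_sq_eq _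
  rw [Fin.sum_univ_three] at h₃
  rw [← h₃] at h₂
  have hg : 0 ≤ toReal maxNormSq := IsNonneg.toReal_nonneg (by decide)
  have h₄ := pow_le_pow_left₀ (by positivity) h₁ 2
  have h₅ : 0 ≤ ‖tupleAvg 24 fun i ↦ vertex (e i)‖ ^ 2 := by positivity
  generalize ‖tupleAvg 24 fun i ↦ vertex (e i)‖ ^ 2 = s at *
  rcases h₅.eq_or_lt with h | h
  · rwa [← h]
  · nlinarith

/-! ### An optimal tuple -/

/-- The vertices in increasing order of their inner product with a maximizer. -/
def optimalLabels : Fin 24 → Label :=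
  ![
    (0, false, false, false), (0, false, false, true), (1, false, false, false),
    (1, false, false, true), (2, false, false, false), (0, false, true, false),
    (0, false, true, true), (2, false, false, true), (1, true, false, false),
    (2, false, true, false), (1, true, false, true), (2, true, false, false),
    (2, false, true, true), (1, false, true, false), (2, true, false, true),
    (1, false, true, true), (2, true, true, false), (0, true, false, false),
    (0, true, false, true), (2, true, true, true), (1, true, true, false),
    (1, true, true, true), (0, true, true, false), (0, true, true, true)]

theorem optimalLabels_bijective : Function.Bijective optimalLabels := by
  rw [Fintype.bijective_iff_injective_and_card]
  exact ⟨by decide +kernel, rfl⟩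

theorem tupleAvg_vertex_apply (f : Fin 24 → Label) (j : Fin 3) :
    tupleAvg 24 (fun i ↦ vertex (f i)) j =
      toReal ⟨∑ i : Fin 24, (2 * (i : ℕ) - 21) * signs (f i) j,
        ∑ i : Fin 24, (2 * (i : ℕ) - 21) * if j = (f i).1 then signs (f i) j else 0⟩ := by
  simp only [tupleAvg, vertex, toReal, WithLp.ofLp_sum, WithLp.ofLp_smul, Finset.sum_apply,
    Pi.smul_apply, smul_eq_mul]
  push_cast
  rw [Finset.sum_mul, ← Finset.sum_add_distrib]
  refine Finset.sum_congr rfl fun i _ ↦ ?_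
  ring

theorem norm_tupleAvg_optimalLabels :
    ‖tupleAvg 24 fun i ↦ vertex (optimalLabels i)‖ ^ 2 = toReal maxNormSq := by
  have h (j : Fin 3) : tupleAvg 24 (fun i ↦ vertex (optimalLabels i)) j =
      toReal (![⟨244, 136⟩, ⟨172, 92⟩, ⟨44, 24⟩] j) := by
    rw [tupleAvg_vertex_apply]
    congr 1
    revert j
    decide +kernel
  rw [EuclideanSpace.real_norm_sq_eq, Fin.sum_univ_three]
  simp only [h, sq, ← toReal_mul, ← toReal_add]
  congr 1

theorem isGreatest_normSqSet :
    IsGreatest (normSqSet rhombicuboctahedron 24) (146128 + 100128 * √2) := by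
  have hmax : 146128 + 100128 * √2 = toReal maxNormSq := by simp [toReal, maxNormSq]
  rw [hmax]
  constructor
  · refine ⟨fun i ↦ vertex (optimalLabels i),
      vertex_injective.comp optimalLabels_bijective.injective, ?_,
      norm_tupleAvg_optimalLabels.symm⟩
    rw [← range_vertex]
    exact optimalLabels_bijective.surjective.range_comp vertex
  · rintro _ ⟨v, hv, hr, rfl⟩
    obtain ⟨e, he⟩ := exists_equiv_of_range_eq hv hr
    rw [funext he]
    exact norm_tupleAvg_sq_le e

/-! ### Scaling -/

theorem tupleAvg_smul (N : ℕ) (c : ℝ) (v : Fin N → E3) :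
    tupleAvg N (c • v) = c • tupleAvg N v := by
  simp only [tupleAvg, Finset.smul_sum, Pi.smul_apply, smul_comm c]

theorem mul_mem_normSqSet {c : ℝ} (hc : c ≠ 0) {S : Set E3} {N : ℕ} {x : ℝ}
    (hx : x ∈ normSqSet S N) : c ^ 2 * x ∈ normSqSet (c • S) N := by
  obtain ⟨v, hv, rfl, rfl⟩ := hx
  refine ⟨c • v, (smul_right_injective E3 hc).comp hv, ?_, ?_⟩
  · rw [← Set.image_smul, ← Set.range_comp]
    rfl
  · rw [tupleAvg_smul, norm_smul, mul_pow, Real.norm_eq_abs, sq_abs]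

theorem isGreatest_normSqSet_smul {c : ℝ} (hc : c ≠ 0) {S : Set E3} {N : ℕ} {g : ℝ}
    (hg : IsGreatest (normSqSet S N) g) : IsGreatest (normSqSet (c • S) N) (c ^ 2 * g) := by
  refine ⟨mul_mem_normSqSet hc hg.1, fun x hx ↦ ?_⟩
  have h := hg.2 (inv_smul_smul₀ hc S ▸ mul_mem_normSqSet (inv_ne_zero hc) hx)
  rwa [inv_pow, inv_mul_le_iff₀ (by positivity)] at h

theorem abs_guesswork_sub_lt :
    |(1 / 2 : ℝ) * (24 + 1 - √((146128 + 100128 * √2) / (5 + 2 * √2)) / 24) - 8.5059| < 0.0001 := by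
  have h₁ : 1.414213 < √2 := Real.lt_sqrt_of_sq_lt (by norm_num)
  have h₂ : √2 < 1.414214 := (Real.sqrt_lt' (by norm_num)).2 (by norm_num)
  have h₃ : 191.713 < √((146128 + 100128 * √2) / (5 + 2 * √2)) := by
    apply Real.lt_sqrt_of_sq_lt
    rw [lt_div_iff₀ (by positivity)]
    linarith
  have h₄ : √((146128 + 100128 * √2) / (5 + 2 * √2)) < 191.717 := by
    rw [Real.sqrt_lt' (by norm_num), div_lt_iff₀ (by positivity)]
    linarith
  rw [abs_lt]
  constructor <;> linarith

end Rhombicuboctahedron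

theorem rhombicuboctahedron_guesswork :
    IsGreatest (normSqSet rhombicuboctahedron 24) (146128 + 100128 * Real.sqrt 2) ∧
    IsGreatest
      (normSqSet ((Real.sqrt (5 + 2 * Real.sqrt 2))⁻¹ • rhombicuboctahedron) 24)
      ((146128 + 100128 * Real.sqrt 2) / (5 + 2 * Real.sqrt 2)) ∧
    |(1 / 2 : ℝ) * (24 + 1 -
        Real.sqrt ((146128 + 100128 * Real.sqrt 2) / (5 + 2 * Real.sqrt 2)) / 24) -
      8.5059| < 0.0001 := by
  have hpos : 0 < 5 + 2 * √2 := by positivity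
  refine ⟨Rhombicuboctahedron.isGreatest_normSqSet, ?_, Rhombicuboctahedron.abs_guesswork_sub_lt⟩
  have h := Rhombicuboctahedron.isGreatest_normSqSet_smul (inv_ne_zero (Real.sqrt_pos.2 hpos).ne')
    Rhombicuboctahedron.isGreatest_normSqSet
  rwa [inv_pow, Real.sq_sqrt hpos.le, ← div_eq_inv_mul] at h
end
end
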